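/- Every 3×3 integer matrix M with |det M| = 1 such that all entries of M and M⁻¹ are nonzero satisfies: some entry of M or of M⁻¹ has absolute value at least 3. -/

import Mathlib

/-- No two rows with entries in `{±1, ±2}` have all three `2 × 2` minors in `{±1, ±2}`. -/
lemma two_rows_aux : ∀ a ∈ [-2, -1, 1, (2 : ℤ)], ∀ d ∈ [-2, -1, 1, (2 : ℤ)],
    ∀ b ∈ [-2, -1, 1, (2 : ℤ)], ∀ e ∈ [-2, -1, 1, (2 : ℤ)],
    a * e - b * d ∈ [-2, -1, 1, (2 : ℤ)] →
    ∀ c ∈ [-2, -1, 1, (2 : ℤ)], ∀ f ∈ [-2, -1, 1, (2 : ℤ)],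
    a * f - c * d ∈ [-2, -1, 1, (2 : ℤ)] →
    ¬ b * f - c * e ∈ [-2, -1, 1, (2 : ℤ)] := by
  decide +kernel

lemma mem_of_small {x : ℤ} (h0 : x ≠ 0) (h : |x| < 3) : x ∈ [-2, -1, 1, (2 : ℤ)] := by
  rw [abs_lt] at h
  simp only [List.mem_cons, List.not_mem_nil, or_false]
  omega

theorem lower_bound_3x3 (M : Matrix (Fin 3) (Fin 3) ℤ)
    (hdet : |M.det| = 1)
    (hM : ∀ i j, M i j ≠ 0) (hMinv : ∀ i j, M⁻¹ i j ≠ 0) :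
    ∃ i j, 3 ≤ |M i j| ∨ 3 ≤ |M⁻¹ i j| := by
  by_contra hcon
  push Not at hcon
  have h1 : ∀ i j, M i j ∈ [-2, -1, 1, (2 : ℤ)] := fun i j =>
    mem_of_small (hM i j) (hcon i j).1
  -- entries of the adjugate agree with those of the inverse up to sign
  have h2 : ∀ i j, M.adjugate i j ≠ 0 ∧ |M.adjugate i j| < 3 := by
    intro i j
    have ha := hMinv i j
    have hb := (hcon i j).2
    have hu : IsUnit M.det := Int.isUnit_iff_abs_eq.2 hdet
    have hadj : M.adjugate = M.det • M⁻¹ := by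
      rw [Matrix.inv_def, smul_smul, Ring.mul_inverse_cancel _ hu, one_smul]
    have he : M.adjugate i j = M.det * M⁻¹ i j := by
      rw [hadj]; rfl
    rw [he]
    refine ⟨mul_ne_zero hu.ne_zero ha, ?_⟩
    rw [abs_mul, hdet, one_mul]
    exact hb
  have e0 := h2 0 2
  have e1 := h2 1 2
  have e2 := h2 2 2
  rw [Matrix.adjugate_fin_three] at e0 e1 e2
  simp at e0 e1 e2
  refine two_rows_aux _ (h1 0 0) _ (h1 1 0) _ (h1 0 1) _ (h1 1 1) (mem_of_small ?_ ?_)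
    _ (h1 0 2) _ (h1 1 2) (mem_of_small ?_ ?_) (mem_of_small ?_ ?_)
  all_goals simp only [abs_lt] at *
  all_goals grind
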